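/- Let m, a, j be positive integers with m ≥ 2a, and let 𝓐' and 𝓑' be cross-intersecting families of a-subsets of [m] such that binom(m-j, a-j) ≤ |𝓐'| ≤ |𝓑'|. Then |𝓐'| + |𝓑'| ≤ binom(m, a) + binom(m-j, a-j) − binom(m-j, a). -/

import Mathlib

open Finset in
/-- Double counting for the inclusion relation between the `p`-subsets and the `q`-subsets of a
finite set `S` with `#S ≤ p + q`. -/
lemma card_le_card_of_subsets_mem {α : Type*} [DecidableEq α] {S : Finset α}
    {F G : Finset (Finset α)} {p q : ℕ} (hqp : q ≤ p) (hS : #S ≤ p + q)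
    (hF : F ⊆ powersetCard p S) (hG : ∀ s ∈ F, powersetCard q s ⊆ G) : #F ≤ #G := by
  set H := G ∩ powersetCard q S with hH
  refine le_trans ?_ (card_le_card (inter_subset_left : H ⊆ G))
  have key : #F * p.choose q ≤ #H * p.choose q := by
    refine card_mul_le_card_mul (fun s t => t ⊆ s) (fun s hs => ?_) (fun t ht => ?_)
    · have hs' := mem_powersetCard.1 (hF hs)
      rw [← hs'.2, ← card_powersetCard]
      refine card_le_card fun t ht => ?_
      have ht' := mem_powersetCard.1 ht
      simp only [mem_bipartiteAbove, hH, mem_inter, mem_powersetCard]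
      exact ⟨⟨hG s hs ht, ht'.1.trans hs'.1, ht'.2⟩, ht'.1⟩
    · have ht' := mem_powersetCard.1 (mem_inter.1 ht).2
      have h1 : #(bipartiteBelow (fun s t => t ⊆ s) F t) ≤ #(powersetCard (p - q) (S \ t)) := by
        refine card_le_card_of_injOn (· \ t) (fun s hs => ?_) (fun s hs s' hs' h => ?_)
        · simp only [mem_coe, mem_bipartiteBelow] at hs
          have hs' := mem_powersetCard.1 (hF hs.1)
          simp only [mem_coe, mem_powersetCard]
          exact ⟨sdiff_subset_sdiff hs'.1 le_rfl,
            by rw [card_sdiff_of_subset hs.2, hs'.2, ht'.2]⟩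
        · simp only [mem_coe, mem_bipartiteBelow] at hs hs'
          rw [← sdiff_union_of_subset hs.2, ← sdiff_union_of_subset hs'.2]
          exact congrArg (· ∪ t) h
      refine h1.trans ?_
      rw [card_powersetCard, card_sdiff_of_subset ht'.1, ht'.2, ← Nat.choose_symm hqp]
      exact Nat.choose_le_choose _ (by omega)
  exact Nat.le_of_mul_le_mul_right key (Nat.choose_pos hqp)

open Finset in
/-- If `#(T ∪ U) < r + a`, then enlarging the family of all `r`-subsets of `T` by further
`r`-subsets of `T ∪ U` adds at least as many `a`-sets below its members as it adds members. -/
lemma card_add_choose_le_card_add_choose {α : Type*} [DecidableEq α] {r a : ℕ} (ha : 0 < a)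
    (har : a ≤ r) {T : Finset α} (hrT : r ≤ #T) (U : Finset α) :
    ∀ {F G : Finset (Finset α)}, Disjoint T U → #(T ∪ U) < r + a →
      powersetCard r T ⊆ F → F ⊆ powersetCard r (T ∪ U) → (∀ s ∈ F, powersetCard a s ⊆ G) →
      #F + (#T).choose a ≤ #G + (#T).choose r := by
  induction U using Finset.induction_on with
  | empty =>
    intro F G _ _ hTF hF hG
    rw [union_empty] at hF
    have h1 := card_le_card hF
    have h2 : powersetCard a T ⊆ G := fun t ht => by
      obtain ⟨htT, hta⟩ := mem_powersetCard.1 ht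
      obtain ⟨s, hts, hsT, hs⟩ := exists_subsuperset_card_eq htT (hta.trans_le har) hrT
      exact hG s (hTF (mem_powersetCard.2 ⟨hsT, hs⟩)) (mem_powersetCard.2 ⟨hts, hta⟩)
    have h2 := card_le_card h2
    rw [card_powersetCard] at h1 h2
    omega
  | insert x U hx ih =>
    intro F G hTU hcard hTF hF hG
    rw [disjoint_insert_right] at hTU
    have hxV : x ∉ T ∪ U := by simp [hx, hTU.1]
    rw [union_insert] at hF hcard
    rw [card_insert_of_notMem hxV] at hcard
    have h0 := ih (F := {s ∈ F | x ∉ s}) (G := {s ∈ G | x ∉ s}) hTU.2 (by omega)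
      (fun s hs => mem_filter.2 ⟨hTF hs, fun h => hTU.1 ((mem_powersetCard.1 hs).1 h)⟩)
      (fun s hs => by
        obtain ⟨hs, hxs⟩ := mem_filter.1 hs
        obtain ⟨hs, hr⟩ := mem_powersetCard.1 (hF hs)
        exact mem_powersetCard.2 ⟨(subset_insert_iff_of_notMem hxs).1 hs, hr⟩)
      (fun s hs t ht => by
        obtain ⟨hs, hxs⟩ := mem_filter.1 hs
        exact mem_filter.2 ⟨hG s hs ht, fun h => hxs ((mem_powersetCard.1 ht).1 h)⟩)
    have hinj : ∀ K : Finset (Finset α),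
        #({s ∈ K | x ∈ s}.image (erase · x)) = #{s ∈ K | x ∈ s} := fun K => by
      refine card_image_of_injOn fun s hs t ht h => ?_
      simp only [mem_coe, mem_filter] at hs ht
      rw [← insert_erase hs.2, ← insert_erase ht.2]
      exact congrArg (insert x) h
    have h1 : #({s ∈ F | x ∈ s}.image (erase · x)) ≤ #({s ∈ G | x ∈ s}.image (erase · x)) := by
      refine card_le_card_of_subsets_mem (S := T ∪ U) (p := r - 1) (q := a - 1) (by omega)
        (by omega) (fun s hs => ?_) (fun s hs t ht => ?_)
      · obtain ⟨s, hsF, rfl⟩ := mem_image.1 hs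
        obtain ⟨hsF, hxs⟩ := mem_filter.1 hsF
        obtain ⟨hsV, hr⟩ := mem_powersetCard.1 (hF hsF)
        exact mem_powersetCard.2 ⟨subset_insert_iff.1 hsV, by rw [card_erase_of_mem hxs, hr]⟩
      · obtain ⟨s, hsF, rfl⟩ := mem_image.1 hs
        obtain ⟨hsF, hxs⟩ := mem_filter.1 hsF
        obtain ⟨ht, hta⟩ := mem_powersetCard.1 ht
        have hxt : x ∉ t := fun h => notMem_erase x s (ht h)
        refine mem_image.2 ⟨insert x t, mem_filter.2 ⟨hG s hsF ?_, mem_insert_self _ _⟩,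
          erase_insert hxt⟩
        refine mem_powersetCard.2 ⟨insert_subset hxs (ht.trans (erase_subset _ _)), ?_⟩
        rw [card_insert_of_notMem hxt, hta]
        omega
    rw [hinj, hinj] at h1
    have hF' := card_filter_add_card_filter_not (s := F) (fun s => x ∈ s)
    have hG' := card_filter_add_card_filter_not (s := G) (fun s => x ∈ s)
    omega

open Finset Colex in
lemma exists_isInitSeg_card_eq {α : Type*} [LinearOrder α] [Fintype α] {r k : ℕ}
    (hk : k ≤ (Fintype.card α).choose r) :
    ∃ 𝒞 : Finset (Finset α), IsInitSeg 𝒞 r ∧ #𝒞 = k := by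
  induction k with
  | zero => exact ⟨∅, isInitSeg_empty, card_empty⟩
  | succ k ih =>
    obtain ⟨𝒞, h𝒞, hcard⟩ := ih (by omega)
    have hne : (powersetCard r univ \ 𝒞 : Finset (Finset α)).Nonempty := by
      rw [← card_pos]
      have := le_card_sdiff 𝒞 (powersetCard r (univ : Finset α))
      rw [card_powersetCard, card_univ] at this
      omega
    obtain ⟨s, hs, hmin⟩ := exists_min_image _ toColex hne
    obtain ⟨hsr, hs𝒞⟩ := mem_sdiff.1 hs
    have hsr := (mem_powersetCard.1 hsr).2
    refine ⟨insert s 𝒞, ⟨fun t ht => ?_, fun t u ht hu => ?_⟩, by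
      rw [card_insert_of_notMem hs𝒞, hcard]⟩
    · rcases mem_insert.1 ht with rfl | ht
      · exact hsr
      · exact h𝒞.1 ht
    · rcases mem_insert.1 ht with rfl | ht
      · by_contra hu'
        rw [mem_insert, not_or] at hu'
        exact (hmin u (mem_sdiff.2 ⟨mem_powersetCard.2 ⟨subset_univ _, hu.2⟩, hu'.2⟩)).not_gt hu.1
      · exact mem_insert_of_mem (h𝒞.2 ht hu)

open Finset Colex in
lemma isInitSeg_powersetCard_Iio {α : Type*} [LinearOrder α] [LocallyFiniteOrderBot α] (r : ℕ)
    (x : α) : IsInitSeg (powersetCard r (Iio x)) r := by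
  refine ⟨Set.sized_powersetCard _ _, fun s t hs ht => mem_powersetCard.2 ⟨fun b hb => ?_, ht.2⟩⟩
  exact mem_Iio.2 (forall_lt_mono ht.1.le
    (fun c hc => mem_Iio.1 ((mem_powersetCard.1 hs).1 hc)) b hb)

open Finset Colex in
lemma Finset.Colex.IsInitSeg.subset_of_card_le {α : Type*} [LinearOrder α]
    {𝒞 𝒟 : Finset (Finset α)} {r : ℕ} (h𝒞 : IsInitSeg 𝒞 r) (h𝒟 : IsInitSeg 𝒟 r)
    (h : #𝒞 ≤ #𝒟) : 𝒞 ⊆ 𝒟 :=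
  (h𝒞.total h𝒟).elim id fun h' => (eq_of_subset_of_card_le h' h).ge

open Finset FinsetFamily in
lemma card_add_card_shadow_compls_le {m a : ℕ} (hm : 2 * a ≤ m)
    {𝒜 ℬ : Finset (Finset (Fin m))} (h𝒜 : (𝒜 : Set (Finset (Fin m))).Sized a)
    (hℬ : (ℬ : Set (Finset (Fin m))).Sized a)
    (hcross : ∀ A ∈ 𝒜, ∀ B ∈ ℬ, (A ∩ B).Nonempty) :
    #ℬ + #(∂^[m - 2 * a] 𝒜ᶜˢ) ≤ m.choose a := by
  have hbar : (𝒜ᶜˢ : Set (Finset (Fin m))).Sized (m - a) := by simpa using h𝒜.compls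
  have hdisj : Disjoint ℬ (∂^[m - 2 * a] 𝒜ᶜˢ) := disjoint_right.2 fun B hB hBℬ => by
    simp only [mem_shadow_iterate_iff_exists_sdiff, mem_compls] at hB
    obtain ⟨C, hC, hBC, _⟩ := hB
    have := hcross _ hC _ hBℬ
    rw [← not_disjoint_iff_nonempty_inter] at this
    exact this (disjoint_of_subset_right hBC disjoint_compl_left)
  rw [← card_union_of_disjoint hdisj]
  have hsized : ((ℬ ∪ ∂^[m - 2 * a] 𝒜ᶜˢ : Finset (Finset (Fin m))) :
      Set (Finset (Fin m))).Sized a := by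
    rw [coe_union, Set.sized_union]
    refine ⟨hℬ, ?_⟩
    have h := hbar.shadow_iterate (k := m - 2 * a)
    rwa [show m - a - (m - 2 * a) = a by omega] at h
  simpa using hsized.card_le

open Finset FinsetFamily Colex in
lemma card_add_card_add_choose_le_of_cross_intersecting {m a j : ℕ} (ha : 0 < a) (hj : 0 < j)
    (hja : j ≤ a) (hm : 2 * a ≤ m) {𝒜 ℬ : Finset (Finset (Fin m))}
    (h𝒜 : (𝒜 : Set (Finset (Fin m))).Sized a) (hℬ : (ℬ : Set (Finset (Fin m))).Sized a)
    (hcross : ∀ A ∈ 𝒜, ∀ B ∈ ℬ, (A ∩ B).Nonempty)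
    (hge : (m - j).choose (a - j) ≤ #𝒜) (hle : #𝒜 ≤ #ℬ) :
    #𝒜 + #ℬ + (m - j).choose a ≤ m.choose a + (m - j).choose (a - j) := by
  have hbound := card_add_card_shadow_compls_le hm h𝒜 hℬ hcross
  have hbar : (𝒜ᶜˢ : Set (Finset (Fin m))).Sized (m - a) := by simpa using h𝒜.compls
  have hsymm : ∀ i, i ≤ a → (m - i).choose (a - i) = (m - i).choose (m - a) := fun i hi =>
    Nat.choose_symm_of_eq_add (by omega)
  have hra : m - a - (m - 2 * a) = a := by omega
  have hupper : #𝒜 ≤ (m - 1).choose (m - a) := by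
    by_contra! hlt
    have hkk := kruskal_katona_lovasz_form (i := m - 2 * a) (r := m - a) (k := m - 1) (by omega)
      (by omega) (by omega) hbar (by rw [card_compls]; exact hlt.le)
    rw [hra] at hkk
    have hpascal : m.choose a = (m - 1).choose (a - 1) + (m - 1).choose a := by
      obtain ⟨m, rfl⟩ := Nat.exists_eq_add_one.2 (show 0 < m by omega)
      obtain ⟨a, rfl⟩ := Nat.exists_eq_add_one.2 ha
      exact Nat.choose_succ_succ m a
    have := hsymm 1 ha
    omega
  obtain ⟨𝒞, h𝒞, hcard⟩ := exists_isInitSeg_card_eq (α := Fin m) (r := m - a) (k := #𝒜) (by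
    rw [Fintype.card_fin]
    exact hupper.trans (Nat.choose_le_choose _ (by omega)))
  have hkk := iterated_kk (k := m - 2 * a) hbar (by rw [hcard, card_compls]) h𝒞
  let x : Fin m := ⟨m - j, by omega⟩
  let y : Fin m := ⟨m - 1, by omega⟩
  have hxy : Iio x ⊆ Iio y := Iio_subset_Iio (Fin.mk_le_mk.2 (by omega))
  have hx : #(Iio x) = m - j := Fin.card_Iio x
  have hy : #(Iio y) = m - 1 := Fin.card_Iio y
  have hTU : Iio x ∪ (Iio y \ Iio x) = Iio y := union_sdiff_of_subset hxy
  have hmain := card_add_choose_le_card_add_choose (r := m - a) (a := a) ha (by omega)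
    (T := Iio x) (by omega) (Iio y \ Iio x) (F := 𝒞) (G := ∂^[m - 2 * a] 𝒞)
    disjoint_sdiff (by rw [hTU]; omega)
    ((isInitSeg_powersetCard_Iio _ x).subset_of_card_le h𝒞 (by
      rw [card_powersetCard, hx, hcard, ← hsymm j hja]; exact hge))
    (by
      rw [hTU]
      exact h𝒞.subset_of_card_le (isInitSeg_powersetCard_Iio _ y) (by
        rw [card_powersetCard, hy, hcard]; exact hupper))
    (fun s hs t ht => by
      obtain ⟨hts, hta⟩ := mem_powersetCard.1 ht
      refine mem_shadow_iterate_iff_exists_sdiff.2 ⟨s, hs, hts, ?_⟩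
      rw [card_sdiff_of_subset hts, hta, h𝒞.1 hs]
      omega)
  rw [hx, hcard, ← hsymm j hja] at hmain
  omega

open Finset in
/-- A family of subsets of `Icc 1 m` is the image of a family of subsets of `Fin m`. -/
lemma exists_map_mapEmbedding_eq {m : ℕ} {𝓐 : Finset (Finset ℕ)}
    (h : ∀ A ∈ 𝓐, A ⊆ Icc 1 m) :
    ∃ 𝒜 : Finset (Finset (Fin m)),
      𝒜.map (mapEmbedding (Fin.valEmbedding.trans (addRightEmbedding 1))).toEmbedding = 𝓐 := by
  set e : Fin m ↪ ℕ := Fin.valEmbedding.trans (addRightEmbedding 1)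
  have hrange : ∀ A ∈ 𝓐, ∃ s : Finset (Fin m), s.map e = A := fun A hA => by
    have : A ⊆ univ.map e := fun i hi => by
      obtain ⟨h1, h2⟩ := mem_Icc.1 (h A hA hi)
      exact mem_map.2 ⟨⟨i - 1, by omega⟩, mem_univ _, by simp [e]; omega⟩
    obtain ⟨s, -, hs⟩ := subset_map_iff.1 this
    exact ⟨s, hs.symm⟩
  refine ⟨({s | s.map e ∈ 𝓐} : Finset (Finset (Fin m))), ?_⟩
  ext A
  simp only [mem_map, mem_filter, mem_univ, true_and, RelEmbedding.coe_toEmbedding,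
    mapEmbedding_apply]
  constructor
  · rintro ⟨s, hs, rfl⟩
    exact hs
  · intro hA
    obtain ⟨s, rfl⟩ := hrange A hA
    exact ⟨s, hA, rfl⟩

/-- Lemma 7 (Frankl–Tokushige type inequality): if `m ≥ 2a`, `m, a, j ≥ 1`,
`𝓐', 𝓑'` are cross-intersecting families of `a`-subsets of `[m]` and
`binom(m-j, a-j) ≤ |𝓐'| ≤ |𝓑'|`, then
`|𝓐'| + |𝓑'| ≤ binom(m,a) + binom(m-j,a-j) − binom(m-j,a)`. -/
theorem lem7 (m a j : ℕ) (ha : 0 < a) (hj : 0 < j) (hm : 2 * a ≤ m)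
    (𝓐' 𝓑' : Finset (Finset ℕ))
    (h𝓐 : ∀ A ∈ 𝓐', A ⊆ Finset.Icc 1 m ∧ A.card = a)
    (h𝓑 : ∀ B ∈ 𝓑', B ⊆ Finset.Icc 1 m ∧ B.card = a)
    (hcross : ∀ A ∈ 𝓐', ∀ B ∈ 𝓑', (A ∩ B).Nonempty)
    (hA_ge : (m - j).choose (a - j) ≤ 𝓐'.card)
    (hAB : 𝓐'.card ≤ 𝓑'.card) :
    𝓐'.card + 𝓑'.card ≤ m.choose a + (m - j).choose (a - j) - (m - j).choose a := by
  obtain ⟨𝒜, rfl⟩ := exists_map_mapEmbedding_eq fun A hA => (h𝓐 A hA).1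
  obtain ⟨ℬ, rfl⟩ := exists_map_mapEmbedding_eq fun B hB => (h𝓑 B hB).1
  simp only [Finset.forall_mem_map, RelEmbedding.coe_toEmbedding, Finset.mapEmbedding_apply,
    Finset.card_map, ← Finset.map_inter, Finset.map_nonempty] at *
  have hmin : (m - min j a).choose (a - min j a) = (m - j).choose (a - j) := by
    rcases le_total j a with h | h
    · rw [min_eq_left h]
    · rw [min_eq_right h, Nat.sub_self, Nat.sub_eq_zero_of_le h, Nat.choose_zero_right,
        Nat.choose_zero_right]
  have hmono : (m - j).choose a ≤ (m - min j a).choose a :=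
    Nat.choose_le_choose a (by omega)
  have hmain := card_add_card_add_choose_le_of_cross_intersecting (j := min j a) ha (by omega)
    (by omega) hm (fun A hA => (h𝓐 A hA).2) (fun B hB => (h𝓑 B hB).2) hcross
    (hmin ▸ hA_ge) hAB
  rw [hmin] at hmain
  omega
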